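/- Let w ∈ ℝ^n be a unit vector (‖w‖₂ = 1), let t ≥ 1, and define A = {x ∈ ℝ^n : ⟨w,x⟩ > t} and B = {x ∈ ℝ^n : ⟨w,x⟩ > −t}. Then Cov_γ(1_A, 1_B) ≤ 2 · W₁^γ(A,B) / ( √(log(e / W₁^γ(A,A))) · √(log(e / W₁^γ(B,B))) ). -/

import Mathlib

open Finset MeasureTheory ProbabilityTheory

/-- The standard Gaussian measure `N(0, I_n)` on `ℝ^n`. -/
noncomputable def stdGaussian (n : ℕ) : Measure (Fin n → ℝ) :=
  Measure.pi fun _ => gaussianReal 0 1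

/-- Covariance of two functions under the standard Gaussian measure. -/
noncomputable def gaussCov (n : ℕ) (f g : (Fin n → ℝ) → ℝ) : ℝ :=
  (∫ x, f x * g x ∂stdGaussian n) -
    (∫ x, f x ∂stdGaussian n) * (∫ x, g x ∂stdGaussian n)

/-- Gaussian influence of coordinate `k` on the set `A`: `I_k^γ(A) = E_γ[1_A · x_k]`. -/
noncomputable def gaussInfluence (n : ℕ) (A : Set (Fin n → ℝ)) (k : Fin n) : ℝ :=
  ∫ x, A.indicator (fun _ => (1 : ℝ)) x * x k ∂stdGaussian n

/-- `W₁^γ(A, B) = ∑ₖ I_k^γ(A) I_k^γ(B)`. -/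
noncomputable def gaussW1 (n : ℕ) (A B : Set (Fin n → ℝ)) : ℝ :=
  ∑ k, gaussInfluence n A k * gaussInfluence n B k

open Filter Topology


lemma gauss_id (n : ℕ) : HasGaussianLaw (fun x : Fin n → ℝ => fun k => x k)
    (Measure.pi fun _ : Fin n => gaussianReal 0 1) := by
  have h1 := iIndepFun_pi (μ := fun _ : Fin n => gaussianReal 0 1) (X := fun _ => id)
      (fun _ => aemeasurable_id)
  refine iIndepFun.hasGaussianLaw (fun i => ?_) h1
  refine ⟨?_⟩
  have : Measure.map (fun x : Fin n → ℝ => x i) (Measure.pi fun _ : Fin n => gaussianReal 0 1)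
    = gaussianReal 0 1 := (measurePreserving_eval (fun _ : Fin n => gaussianReal 0 1) i).map_eq
  rw [this]; infer_instance

lemma cov_coord (n : ℕ) (i j : Fin n) :
    cov[fun x : Fin n → ℝ => x i, fun x => x j; Measure.pi fun _ : Fin n => gaussianReal 0 1]
      = if i = j then 1 else 0 := by
  have hG : HasGaussianLaw (fun x : Fin n → ℝ => fun k => x k)
    (Measure.pi fun _ : Fin n => gaussianReal 0 1) := gauss_id n
  split_ifs with h
  · subst h
    rw [covariance_self (measurable_pi_apply i).aemeasurable]
    have := variance_map (μ := Measure.pi fun _ : Fin n => gaussianReal 0 1) (X := id)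
      (Y := Function.eval i) aemeasurable_id (measurable_pi_apply i).aemeasurable
    rw [(measurePreserving_eval (fun _ : Fin n => gaussianReal 0 1) i).map_eq] at this
    simpa [Function.comp_def] using this.symm
  · have h1 := iIndepFun_pi (μ := fun _ : Fin n => gaussianReal 0 1) (X := fun _ => id)
      (fun _ => aemeasurable_id)
    exact (h1.indepFun h).covariance_eq_zero (hG.eval i).memLp_two (hG.eval j).memLp_two

lemma mean_coord (n : ℕ) (i : Fin n) :
    ∫ x : Fin n → ℝ, x i ∂(Measure.pi fun _ : Fin n => gaussianReal 0 1) = 0 := by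
  rw [integral_eval]; simp

lemma gauss_law (n : ℕ) (w : Fin n → ℝ) (hw : (∑ i, w i ^ 2) = 1) :
    (Measure.pi fun _ : Fin n => gaussianReal 0 1).map (fun x => ∑ i, w i * x i)
      = gaussianReal 0 1 := by
  have hG : HasGaussianLaw (fun x : Fin n → ℝ => fun k => x k)
    (Measure.pi fun _ : Fin n => gaussianReal 0 1) := gauss_id n
  have hS : HasGaussianLaw (fun x : Fin n → ℝ => ∑ i, w i * x i)
      (Measure.pi fun _ : Fin n => gaussianReal 0 1) := by
    have := hG.map_fun (∑ i, w i • ContinuousLinearMap.proj (R := ℝ) (φ := fun _ : Fin n => ℝ) i)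
    simpa using this
  have hm : ∀ i, MemLp (fun x : Fin n → ℝ => w i * x i) 2
      (Measure.pi fun _ : Fin n => gaussianReal 0 1) := fun i => (hG.eval i).memLp_two.const_mul _
  rw [hS.map_eq_gaussianReal]
  congr 1
  · rw [integral_finsetSum _ (fun i _ => (hm i).integrable (by norm_num))]
    simp [integral_const_mul, mean_coord]
  · rw [← covariance_self hS.aemeasurable, covariance_fun_sum_fun_sum hm hm]
    simp [covariance_const_mul_left, covariance_const_mul_right, cov_coord, ← sq, hw]

lemma influence_aux (n : ℕ) (w : Fin n → ℝ) (hw : (∑ i, w i ^ 2) = 1) (k : Fin n)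
    (f : ℝ → ℝ) (hf : Measurable f) (hb : ∀ s, ‖f s‖ ≤ 1) :
    ∫ x : Fin n → ℝ, f (∑ i, w i * x i) * x k ∂(Measure.pi fun _ : Fin n => gaussianReal 0 1)
      = w k * ∫ s, f s * s ∂(gaussianReal 0 1) := by
  set μ := Measure.pi fun _ : Fin n => gaussianReal 0 1 with hμ
  have hG : HasGaussianLaw (fun x : Fin n → ℝ => fun k => x k) μ := gauss_id n
  have hSR : HasGaussianLaw (fun x : Fin n → ℝ => (∑ i, w i * x i, x k - w k * ∑ i, w i * x i)) μ := by
    let L := ∑ i, w i • ContinuousLinearMap.proj (R := ℝ) (φ := fun _ : Fin n => ℝ) i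
    have := hG.map_fun (L.prod (ContinuousLinearMap.proj (R := ℝ) (φ := fun _ : Fin n => ℝ) k - w k • L))
    simpa [L] using this
  have hS := hSR.fst
  have hR := hSR.snd
  have hm : ∀ i, MemLp (fun x : Fin n → ℝ => w i * x i) 2 μ :=
    fun i => (hG.eval i).memLp_two.const_mul _
  have hind : IndepFun (fun x : Fin n → ℝ => ∑ i, w i * x i)
      (fun x => x k - w k * ∑ i, w i * x i) μ := by
    apply hSR.indepFun_of_covariance_eq_zero
    rw [covariance_fun_sub_right hS.memLp_two (hG.eval k).memLp_two (hS.memLp_two.const_mul _),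
      covariance_const_mul_right, covariance_fun_sum_fun_sum hm hm,
      covariance_fun_sum_left hm (hG.eval k).memLp_two]
    simp [covariance_const_mul_left, covariance_const_mul_right, hμ, cov_coord, ← sq, hw]
  have hSm : Measurable (fun x : Fin n → ℝ => ∑ i, w i * x i) := by fun_prop
  have hfi : ∀ g : (Fin n → ℝ) → ℝ, Integrable g μ → 
      Integrable (fun x => f (∑ i, w i * x i) * g x) μ := fun g hg =>
    hg.bdd_mul (c := 1) (hf.comp hSm).aestronglyMeasurable (by filter_upwards with x using hb _)
  have e : ∀ x : Fin n → ℝ, f (∑ i, w i * x i) * x k =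
      w k * (f (∑ i, w i * x i) * (∑ i, w i * x i)) +
       f (∑ i, w i * x i) * (x k - w k * ∑ i, w i * x i) := fun x => by ring
  simp_rw [e]
  rw [integral_add ((hfi _ hS.integrable).const_mul _) (hfi _ hR.integrable), integral_const_mul]
  have h0 : ∫ x : Fin n → ℝ, f (∑ i, w i * x i) * (x k - w k * ∑ i, w i * x i) ∂μ = 0 := by
    have := (hind.comp hf measurable_id).integral_fun_mul_eq_mul_integral
      (hf.comp hSm).aestronglyMeasurable hR.integrable.aestronglyMeasurable
    simp only [Function.comp_def, id] at this
    rw [this, integral_sub (hG.eval k).integrable (hS.integrable.const_mul _), mean_coord,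
      integral_const_mul, integral_finsetSum _ (fun i _ => (hm i).integrable (by norm_num))]
    simp [integral_const_mul, hμ, mean_coord]
  rw [h0, add_zero, ← gauss_law n w hw, integral_map hSm.aemeasurable]
  exact (hf.mul measurable_id).aestronglyMeasurable


noncomputable def gphi (x : ℝ) : ℝ := (Real.sqrt (2 * Real.pi))⁻¹ * Real.exp (-(x ^ 2) / 2)

lemma gphi_eq : gaussianPDFReal 0 1 = gphi := by
  ext x; simp [gaussianPDFReal, gphi]

lemma gphi_pos (x : ℝ) : 0 < gphi x := by unfold gphi; positivity

lemma gphi_deriv (x : ℝ) : HasDerivAt gphi (-(x * gphi x)) x := by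
  have h : HasDerivAt (fun y : ℝ => -(y ^ 2) / 2) (-x) x := by
    exact ((hasDerivAt_pow 2 x).neg.div_const 2).congr_deriv (by push_cast; ring)
  exact (h.exp.const_mul ((Real.sqrt (2 * Real.pi))⁻¹)).congr_deriv (by unfold gphi; ring)

lemma gphi_tendsto : Tendsto gphi atTop (𝓝 0) := by
  have h : Tendsto (fun y : ℝ => -(y ^ 2) / 2) atTop atBot := by
    have : Tendsto (fun y : ℝ => y ^ 2 / 2) atTop atTop :=
      (tendsto_pow_atTop (by norm_num)).atTop_div_const (by norm_num)
    convert tendsto_neg_atTop_atBot.comp this using 2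
    simp [neg_div]
  simpa [gphi, Function.comp_def, funext_iff, show gphi = fun x => (Real.sqrt (2 * Real.pi))⁻¹ * Real.exp (-(x ^ 2) / 2) from rfl] using (Real.tendsto_exp_atBot.comp h).const_mul _

lemma gint (f : ℝ → ℝ) (t : ℝ) :
    ∫ s, (Set.Ioi t).indicator (fun _ => (1:ℝ)) s * f s ∂(gaussianReal 0 1)
      = ∫ s in Set.Ioi t, gphi s * f s := by
  rw [integral_gaussianReal_eq_integral_smul (by norm_num), gphi_eq, ← integral_indicator measurableSet_Ioi]
  congr 1; ext s
  by_cases h : s ∈ Set.Ioi t <;> simp [h]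

lemma gint_id (t : ℝ) :
    ∫ s, (Set.Ioi t).indicator (fun _ => (1:ℝ)) s * s ∂(gaussianReal 0 1) = gphi t := by
  rw [gint]
  have hi : Integrable (fun s => gphi s * s) := by
    have h : Integrable (fun s : ℝ => s) (gaussianReal 0 1) := IsGaussian.integrable_id
    rw [gaussianReal_of_var_ne_zero _ (by norm_num)] at h
    unfold gaussianPDF at h
    rw [integrable_withDensity_iff_integrable_smul₀' (by fun_prop) (by simp)] at h
    simpa [ENNReal.toReal_ofReal, gaussianPDFReal_nonneg, gphi_eq, (gphi_pos _).le] using h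
  have := integral_Ioi_of_hasDerivAt_of_tendsto' (a := t) (f := fun s => - gphi s)
    (f' := fun s => gphi s * s) (m := 0) (fun x _ => by
      exact (gphi_deriv x).neg.congr_deriv (by ring)) hi.integrableOn (by simpa using gphi_tendsto.neg)
  simpa using this

noncomputable def RR (x : ℝ) : ℝ := (x^4 + 9*x^2 + 8) / (x^5 + 10*x^3 + 15*x)

lemma tail_bound (t : ℝ) (ht : 1 ≤ t) :
    ∫ s, (Set.Ioi t).indicator (fun _ => (1:ℝ)) s ∂(gaussianReal 0 1) ≤ gphi t * RR t := by
  have h0 := gint (fun _ => 1) t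
  simp only [mul_one] at h0
  rw [h0]
  let g' : ℝ → ℝ := fun x => -(x * gphi x) * RR x + gphi x *
    (((4*x^3+18*x) * (x^5 + 10*x^3 + 15*x) - (x^4 + 9*x^2 + 8) * (5*x^4+30*x^2+15)) / (x^5 + 10*x^3 + 15*x)^2)
  have hle : ∀ x, t ≤ x → gphi x ≤ - g' x := by
    intro x hx
    have hx0 : 0 < x := by linarith
    have hd : 0 < x^5 + 10*x^3 + 15*x := by positivity
    have : - g' x - gphi x = gphi x * (120 / (x^5 + 10*x^3 + 15*x)^2) := by
      simp only [g', RR]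
      field_simp
      ring
    have h2 : 0 ≤ gphi x * (120 / (x^5 + 10*x^3 + 15*x)^2) := by
      have := gphi_pos x; positivity
    linarith
  have hder : ∀ x ∈ Set.Ici t, HasDerivAt (fun x => gphi x * RR x) (g' x) x := by
    intro x hx
    have hx0 : 0 < x := by have : t ≤ x := hx; linarith
    have hd : 0 < x^5 + 10*x^3 + 15*x := by positivity
    apply (gphi_deriv x).mul
    refine HasDerivAt.div (c := fun x : ℝ => x^4 + 9*x^2 + 8) (d := fun x : ℝ => x^5 + 10*x^3 + 15*x) ?_ ?_ hd.ne'
    · have := ((hasDerivAt_pow 4 x).add ((hasDerivAt_pow 2 x).const_mul 9)).add_const 8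
      exact this.congr_deriv (by push_cast; ring)
    · have := ((hasDerivAt_pow 5 x).add ((hasDerivAt_pow 3 x).const_mul 10)).add ((hasDerivAt_id x).const_mul 15)
      exact this.congr_deriv (by push_cast; ring)
  have hlim : Tendsto (fun x => gphi x * RR x) atTop (𝓝 0) := by
    refine squeeze_zero' (g := gphi) ?_ ?_ gphi_tendsto
    · filter_upwards [eventually_ge_atTop 1] with x hx
      have := gphi_pos x
      unfold RR; positivity
    · filter_upwards [eventually_ge_atTop 1] with x hx
      have := gphi_pos x
      have : RR x ≤ 1 := by
        unfold RR
        rw [div_le_one (by positivity)]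
        have h2 : 0 ≤ x - 1 := by linarith
        have : 0 ≤ (x-1)^5 + 4*(x-1)^4+16*(x-1)^3+25*(x-1)^2 + 28*(x-1) + 8 := by positivity
        have h3 : x^5 + 10*x^3 + 15*x - (x^4 + 9*x^2 + 8) = x^4*(x-1) + 9*x^2*(x-1) + x^3 + 8*(x-1) + 7*x := by ring
        have : 0 ≤ x^4*(x-1) + 9*x^2*(x-1) + x^3 + 8*(x-1) + 7*x := by positivity
        linarith
      nlinarith
  have hneg : ∀ x ∈ Set.Ioi t, g' x ≤ 0 := fun x hx => by
    have := hle x (le_of_lt hx); have := gphi_pos x; linarith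
  have hI := integral_Ioi_of_hasDerivAt_of_nonpos' hder hneg hlim
  have hint := integrableOn_Ioi_deriv_of_nonpos' hder hneg hlim
  calc ∫ s in Set.Ioi t, gphi s ≤ ∫ s in Set.Ioi t, - g' s := by
        apply setIntegral_mono_on _ hint.neg measurableSet_Ioi (fun x hx => hle x (le_of_lt hx))
        rw [← gphi_eq]; exact (integrable_gaussianPDFReal 0 1).integrableOn
    _ = _ := by rw [integral_neg, hI]; ring

lemma RR_bound (t : ℝ) (ht : 1 ≤ t) : RR t ^ 2 * (3 + t^2) ≤ 2 := by
  unfold RR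
  have h : 0 < t^5 + 10*t^3 + 15*t := by positivity
  rw [div_pow, div_mul_eq_mul_div, div_le_iff₀ (by positivity)]
  have hy : 0 ≤ t^2 - 1 := by nlinarith
  have e : 2 * (t^5 + 10*t^3 + 15*t)^2 - (t^4 + 9*t^2 + 8)^2 * (3+t^2)
    = (t^2-1)*(t^8+20*t^6+129*t^4+294*t^2+248)+56 := by ring
  have : 0 ≤ (t^2-1)*(t^8+20*t^6+129*t^4+294*t^2+248)+56 := by positivity
  linarith

lemma log_bound (t : ℝ) : 
   Real.log (Real.exp 1 / (gphi t * gphi t)) ≤ 3 + t^2 ∧ 0 < Real.log (Real.exp 1 / (gphi t * gphi t)) := by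
  have h : Real.log (Real.exp 1 / (gphi t * gphi t)) = 1 + Real.log (2 * Real.pi) + t^2 := by
    have : Real.exp 1 / (gphi t * gphi t) = Real.exp (1 + t^2) * (2 * Real.pi) := by
      unfold gphi
      have hs : Real.sqrt (2 * Real.pi) * Real.sqrt (2 * Real.pi) = 2 * Real.pi := 
        Real.mul_self_sqrt (by positivity)
      have : (Real.sqrt (2 * Real.pi))⁻¹ * Real.exp (-(t ^ 2) / 2) * ((Real.sqrt (2 * Real.pi))⁻¹ * Real.exp (-(t ^ 2) / 2)) = (2*Real.pi)⁻¹ * Real.exp (-t^2) := by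
        rw [mul_mul_mul_comm, ← mul_inv, hs, ← Real.exp_add]; ring_nf
      rw [this, Real.exp_add, Real.exp_neg]
      field_simp
    rw [this, Real.log_mul (by positivity) (by positivity), Real.log_exp]; ring
  have h1 : Real.log (2 * Real.pi) ≤ 2 := by
    rw [Real.log_le_iff_le_exp (by positivity)]
    have : Real.exp 2 = Real.exp 1 * Real.exp 1 := by rw [← Real.exp_add]; norm_num
    rw [this]
    nlinarith [Real.exp_one_gt_d9, Real.pi_lt_d2]
  have h2 : 0 ≤ Real.log (2 * Real.pi) := Real.log_nonneg (by nlinarith [Real.pi_gt_three])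
  rw [h]; constructor <;> nlinarith [sq_nonneg t]

lemma final_bound (t p : ℝ) (ht : 1 ≤ t) (hp0 : 0 ≤ p) (hp : p ≤ gphi t * RR t) :
    p ^ 2 ≤ 2 * (gphi t * gphi t) / (Real.sqrt (Real.log (Real.exp 1 / (gphi t * gphi t))) *
      Real.sqrt (Real.log (Real.exp 1 / (gphi t * gphi t)))) := by
  obtain ⟨h1, h2⟩ := log_bound t
  rw [Real.mul_self_sqrt h2.le, le_div_iff₀ h2]
  calc p^2 * _ ≤ (gphi t * RR t)^2 * (3+t^2) := by gcongr
    _ = (gphi t * gphi t) * (RR t ^ 2 * (3 + t^2)) := by ring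
    _ ≤ (gphi t * gphi t) * 2 := by
      have := gphi_pos t
      gcongr; exact RR_bound t ht
    _ = _ := by ring

lemma gauss_symm (t : ℝ) :
    ∫ s, (Set.Ioi (-t)).indicator (fun _ => (1:ℝ)) s ∂(gaussianReal 0 1)
      = 1 - ∫ s, (Set.Ioi t).indicator (fun _ => (1:ℝ)) s ∂(gaussianReal 0 1) := by
  rw [integral_indicator_const _ measurableSet_Ioi, integral_indicator_const _ measurableSet_Ioi]
  have hna : NullSingletonClass (gaussianReal 0 1) := nullSingletonClass_gaussianReal (by norm_num)
  have h1 : (gaussianReal 0 1).real (Set.Ioi (-t)) = 1 - (gaussianReal 0 1).real (Set.Iic (-t)) := by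
    rw [← Set.compl_Iic, probReal_compl_eq_one_sub measurableSet_Iic]
  have h2 : (gaussianReal 0 1).real (Set.Iic (-t)) = (gaussianReal 0 1).real (Set.Ioi t) := by
    have e := gaussianReal_map_neg (μ := 0) (v := 1)
    rw [neg_zero] at e
    conv_lhs => rw [← e]
    rw [map_measureReal_apply (by fun_prop) measurableSet_Iic]
    have : (fun x : ℝ => -x) ⁻¹' Set.Iic (-t) = Set.Ici t := by ext; simp
    rw [this]
    exact (measureReal_congr Ioi_ae_eq_Ici).symm
  rw [h1, h2]; simp

lemma infl_half (n : ℕ) (w : Fin n → ℝ) (hw : (∑ i, w i ^ 2) = 1) (t : ℝ) (k : Fin n) :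
    gaussInfluence n {x | t < ∑ i, w i * x i} k = w k * gphi t := by
  rw [← gint_id t, ← influence_aux n w hw k _ (measurable_const.indicator measurableSet_Ioi)]
  · rfl
  · intro s
    by_cases h : s ∈ Set.Ioi t <;> simp [h]

lemma W_half (n : ℕ) (w : Fin n → ℝ) (hw : (∑ i, w i ^ 2) = 1) (s t : ℝ) :
    gaussW1 n {x | s < ∑ i, w i * x i} {x | t < ∑ i, w i * x i} = gphi s * gphi t := by
  unfold gaussW1
  simp_rw [infl_half n w hw]
  calc _ = ∑ k, w k ^ 2 * (gphi s * gphi t) := Finset.sum_congr rfl fun k _ => by ring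
    _ = _ := by rw [← Finset.sum_mul, hw, one_mul]

lemma prob_half (n : ℕ) (w : Fin n → ℝ) (hw : (∑ i, w i ^ 2) = 1) (t : ℝ) :
    ∫ x, Set.indicator {x | t < ∑ i, w i * x i} (fun _ => (1:ℝ)) x
      ∂(Measure.pi fun _ : Fin n => gaussianReal 0 1)
      = ∫ s, (Set.Ioi t).indicator (fun _ => (1:ℝ)) s ∂(gaussianReal 0 1) := by
  conv_rhs => rw [← gauss_law n w hw]
  rw [integral_map]
  · rfl
  · exact Measurable.aemeasurable (by fun_prop)
  · exact (measurable_const.indicator measurableSet_Ioi).aestronglyMeasurable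

/-- Tightness example: nested halfspaces `A = {⟨w,x⟩ > t}`, `B = {⟨w,x⟩ > -t}` with `t ≥ 1`. -/
theorem stmt3 (n : ℕ) (w : Fin n → ℝ) (hw : (∑ i, w i ^ 2) = 1) (t : ℝ) (ht : 1 ≤ t) :
    gaussCov n (Set.indicator {x | t < ∑ i, w i * x i} fun _ => 1)
        (Set.indicator {x | -t < ∑ i, w i * x i} fun _ => 1) ≤
      2 * gaussW1 n {x | t < ∑ i, w i * x i} {x | -t < ∑ i, w i * x i} /
        (Real.sqrt (Real.log (Real.exp 1 /
            gaussW1 n {x | t < ∑ i, w i * x i} {x | t < ∑ i, w i * x i})) *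
         Real.sqrt (Real.log (Real.exp 1 /
            gaussW1 n {x | -t < ∑ i, w i * x i} {x | -t < ∑ i, w i * x i}))) := by
  have hneg : gphi (-t) = gphi t := by simp [gphi]
  simp only [W_half n w hw, hneg]
  have hc : gaussCov n (Set.indicator {x | t < ∑ i, w i * x i} fun _ => 1)
        (Set.indicator {x | -t < ∑ i, w i * x i} fun _ => 1) =
      (∫ s, (Set.Ioi t).indicator (fun _ => (1:ℝ)) s ∂(gaussianReal 0 1)) ^ 2 := by
    have hm : ∀ x : Fin n → ℝ, Set.indicator {x | t < ∑ i, w i * x i} (fun _ => (1:ℝ)) x *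
        Set.indicator {x | -t < ∑ i, w i * x i} (fun _ => (1:ℝ)) x =
        Set.indicator {x | t < ∑ i, w i * x i} (fun _ => (1:ℝ)) x := by
      intro x
      by_cases h : t < ∑ i, w i * x i
      · have h2 : -t < ∑ i, w i * x i := by linarith
        simp [h, h2]
      · simp [h]
    unfold gaussCov
    simp_rw [hm]
    unfold _root_.stdGaussian
    rw [prob_half n w hw, prob_half n w hw, gauss_symm]
    ring
  rw [hc]
  refine final_bound t _ ht (integral_nonneg fun s => ?_) (tail_bound t ht)
  exact Set.indicator_nonneg (fun _ _ => zero_le_one) s
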